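/- Let A, B, X, Y ∈ B(H) and set ν = (c(Re(A))² + c(Im(A))²)/2 + |(‖Re(A)‖² − ‖Im(A)‖²)/2 + (c(Im(A))² − c(Re(A))²)/2|. Then w(AXB + BYA) ≤ 2√2 · ‖B‖ · max{‖X‖, ‖Y‖} · √(w(A)² − ν) and w(AXB − BYA) ≤ 2√2 · ‖B‖ · max{‖X‖, ‖Y‖} · √(w(A)² − ν). -/

import Mathlib

open ContinuousLinearMap Filter
open scoped ComplexInnerProductSpace Topology

variable {H : Type*} [NormedAddCommGroup H] [InnerProductSpace ℂ H]
  [CompleteSpace H] [Nontrivial H]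

/-- The numerical range of a bounded linear operator. -/
noncomputable def numRange (A : H →L[ℂ] H) : Set ℂ :=
  {z : ℂ | ∃ x : H, ‖x‖ = 1 ∧ z = ⟪x, A x⟫}

/-- The numerical radius of a bounded linear operator. -/
noncomputable def numRadius (A : H →L[ℂ] H) : ℝ :=
  sSup {r : ℝ | ∃ x : H, ‖x‖ = 1 ∧ r = ‖(⟪x, A x⟫)‖}

/-- The Crawford number of a bounded linear operator. -/
noncomputable def crawford (A : H →L[ℂ] H) : ℝ :=
  sInf {r : ℝ | ∃ x : H, ‖x‖ = 1 ∧ r = ‖(⟪x, A x⟫)‖}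

/-- The real part `(A + A*)/2` of a bounded linear operator. -/
noncomputable def reOp (A : H →L[ℂ] H) : H →L[ℂ] H :=
  (2 : ℂ)⁻¹ • (A + ContinuousLinearMap.adjoint A)

/-- The imaginary part `(A - A*)/(2i)` of a bounded linear operator. -/
noncomputable def imOp (A : H →L[ℂ] H) : H →L[ℂ] H :=
  (2 * Complex.I)⁻¹ • (A - ContinuousLinearMap.adjoint A)

/-- Every value of the quadratic form on the unit sphere is bounded by the numerical radius. -/
theorem norm_inner_le_numRadius (A : H →L[ℂ] H) {x : H} (hx : ‖x‖ = 1) :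
    ‖⟪x, A x⟫‖ ≤ numRadius A := by
  refine le_csSup ⟨‖A‖, ?_⟩ ⟨x, hx, rfl⟩
  rintro r ⟨y, hy, rfl⟩
  calc ‖⟪y, A y⟫‖ ≤ ‖y‖ * ‖A y‖ := norm_inner_le_norm _ _
    _ ≤ ‖y‖ * (‖A‖ * ‖y‖) := by gcongr; exact A.le_opNorm y
    _ = ‖A‖ := by simp [hy]

theorem numRadius_le {A : H →L[ℂ] H} {M : ℝ} (h : ∀ x : H, ‖x‖ = 1 → ‖⟪x, A x⟫‖ ≤ M) :
    numRadius A ≤ M := by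
  obtain ⟨x, hx⟩ := exists_norm_eq H zero_le_one
  refine csSup_le ⟨_, x, hx, rfl⟩ ?_
  rintro r ⟨y, hy, rfl⟩
  exact h y hy

theorem crawford_le (A : H →L[ℂ] H) {x : H} (hx : ‖x‖ = 1) : crawford A ≤ ‖⟪x, A x⟫‖ := by
  refine csInf_le ⟨0, ?_⟩ ⟨x, hx, rfl⟩
  rintro r ⟨y, -, rfl⟩
  exact norm_nonneg _

theorem crawford_nonneg (A : H →L[ℂ] H) : 0 ≤ crawford A := by
  refine Real.sInf_nonneg ?_
  rintro r ⟨y, -, rfl⟩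
  exact norm_nonneg _

theorem inner_adjoint_self_right (A : H →L[ℂ] H) (x : H) :
    ⟪x, adjoint A x⟫ = (starRingEnd ℂ) ⟪x, A x⟫ := by
  rw [adjoint_inner_right, inner_conj_symm]

theorem inner_reOp_self (A : H →L[ℂ] H) (x : H) : ⟪x, reOp A x⟫ = ((⟪x, A x⟫).re : ℂ) := by
  have h : ⟪x, reOp A x⟫ = 2⁻¹ * (⟪x, A x⟫ + ⟪x, adjoint A x⟫) := by
    simp only [reOp, smul_apply, add_apply, inner_smul_right, inner_add_right]
  rw [h, inner_adjoint_self_right, Complex.add_conj]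
  push_cast
  ring

theorem inner_imOp_self (A : H →L[ℂ] H) (x : H) : ⟪x, imOp A x⟫ = ((⟪x, A x⟫).im : ℂ) := by
  have h : ⟪x, imOp A x⟫ = (2 * Complex.I)⁻¹ * (⟪x, A x⟫ - ⟪x, adjoint A x⟫) := by
    simp only [imOp, smul_apply, sub_apply, inner_smul_right, inner_sub_right]
  rw [h, inner_adjoint_self_right, Complex.sub_conj]
  push_cast
  field_simp

/-- An operator with real quadratic form is symmetric. -/
theorem isSymmetric_of_inner_self_eq_ofReal {T : H →L[ℂ] H} {f : H → ℝ}
    (h : ∀ x, ⟪x, T x⟫ = (f x : ℂ)) : (T : H →ₗ[ℂ] H).IsSymmetric := by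
  rw [LinearMap.isSymmetric_iff_inner_map_self_real]
  intro x
  change (starRingEnd ℂ) ⟪T x, x⟫ = ⟪T x, x⟫
  rw [inner_conj_symm, ← inner_conj_symm (T x) x, h, Complex.conj_ofReal]

/-- The norm of a symmetric operator is controlled by its quadratic form on the unit sphere. -/
theorem norm_le_of_norm_inner_self_le {T : H →L[ℂ] H} (hT : (T : H →ₗ[ℂ] H).IsSymmetric) {M : ℝ}
    (hM : 0 ≤ M) (h : ∀ x : H, ‖x‖ = 1 → ‖⟪x, T x⟫‖ ≤ M) : ‖T‖ ≤ M := by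
  rw [T.norm_eq_iSup_rayleighQuotient hT]
  refine ciSup_le fun x => ?_
  rcases eq_or_ne x 0 with rfl | hx
  · simpa using hM
  have hn : ‖((‖x‖⁻¹ : ℝ) : ℂ) • x‖ = 1 := by
    simp [norm_smul, hx]
  have hc : ((‖x‖⁻¹ : ℝ) : ℂ) ≠ 0 := by simpa using hx
  rw [← T.rayleigh_smul x hc, rayleighQuotient, hn, reApplyInnerSelf_apply, one_pow, div_one]
  refine (RCLike.abs_re_le_norm _).trans ?_
  rw [norm_inner_symm]
  exact h _ hn

theorem norm_sq_add_le_of_symmetric {A T : H →L[ℂ] H} {c : ℝ}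
    (hT : (T : H →ₗ[ℂ] H).IsSymmetric)
    (h : ∀ x : H, ‖x‖ = 1 → ‖⟪x, T x⟫‖ ^ 2 + c ^ 2 ≤ ‖⟪x, A x⟫‖ ^ 2) :
    ‖T‖ ^ 2 + c ^ 2 ≤ numRadius A ^ 2 := by
  have key : ∀ x : H, ‖x‖ = 1 → ‖⟪x, T x⟫‖ ^ 2 ≤ numRadius A ^ 2 - c ^ 2 := fun x hx => by
    have := pow_le_pow_left₀ (norm_nonneg _) (norm_inner_le_numRadius A hx) 2
    linarith [h x hx]
  obtain ⟨x, hx⟩ := exists_norm_eq H zero_le_one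
  have hs : 0 ≤ numRadius A ^ 2 - c ^ 2 := (sq_nonneg _).trans (key x hx)
  have hN : ‖T‖ ≤ √(numRadius A ^ 2 - c ^ 2) :=
    norm_le_of_norm_inner_self_le hT (Real.sqrt_nonneg _) fun y hy => Real.le_sqrt_of_sq_le (key y hy)
  have := pow_le_pow_left₀ (norm_nonneg _) hN 2
  rw [Real.sq_sqrt hs] at this
  linarith

theorem norm_reOp_sq_add_crawford_imOp_sq_le (A : H →L[ℂ] H) :
    ‖reOp A‖ ^ 2 + crawford (imOp A) ^ 2 ≤ numRadius A ^ 2 := by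
  refine norm_sq_add_le_of_symmetric (isSymmetric_of_inner_self_eq_ofReal (inner_reOp_self A))
    fun x hx => ?_
  have h := pow_le_pow_left₀ (crawford_nonneg _) (crawford_le (imOp A) hx) 2
  rw [inner_imOp_self, Complex.norm_real, Real.norm_eq_abs, sq_abs] at h
  rw [inner_reOp_self, Complex.norm_real, Real.norm_eq_abs, sq_abs, Complex.sq_norm,
    Complex.normSq_apply]
  linarith

theorem norm_imOp_sq_add_crawford_reOp_sq_le (A : H →L[ℂ] H) :
    ‖imOp A‖ ^ 2 + crawford (reOp A) ^ 2 ≤ numRadius A ^ 2 := by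
  refine norm_sq_add_le_of_symmetric (isSymmetric_of_inner_self_eq_ofReal (inner_imOp_self A))
    fun x hx => ?_
  have h := pow_le_pow_left₀ (crawford_nonneg _) (crawford_le (reOp A) hx) 2
  rw [inner_reOp_self, Complex.norm_real, Real.norm_eq_abs, sq_abs] at h
  rw [inner_imOp_self, Complex.norm_real, Real.norm_eq_abs, sq_abs, Complex.sq_norm,
    Complex.normSq_apply]
  linarith

/-- The parallelogram law for the Cartesian decomposition `A = Re A + i Im A`. -/
theorem norm_apply_sq_add_norm_adjoint_apply_sq (A : H →L[ℂ] H) (x : H) :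
    ‖A x‖ ^ 2 + ‖adjoint A x‖ ^ 2 = 2 * (‖reOp A x‖ ^ 2 + ‖imOp A x‖ ^ 2) := by
  have hre : ‖reOp A x‖ = 2⁻¹ * ‖A x + adjoint A x‖ := by
    simp [reOp, norm_smul, -smul_add]
  have him : ‖imOp A x‖ = 2⁻¹ * ‖A x - adjoint A x‖ := by
    simp [imOp, norm_smul]
  have := parallelogram_law_with_norm ℂ (A x) (adjoint A x)
  rw [hre, him]
  linarith

theorem norm_apply_add_norm_adjoint_apply_le (A : H →L[ℂ] H) {x : H} (hx : ‖x‖ = 1) :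
    ‖A x‖ + ‖adjoint A x‖ ≤ 2 * √(‖reOp A‖ ^ 2 + ‖imOp A‖ ^ 2) := by
  have hre := pow_le_pow_left₀ (norm_nonneg _) ((reOp A).unit_le_opNorm x hx.le) 2
  have him := pow_le_pow_left₀ (norm_nonneg _) ((imOp A).unit_le_opNorm x hx.le) 2
  have hsum := norm_apply_sq_add_norm_adjoint_apply_sq A x
  refine abs_le_of_sq_le_sq' ?_ (by positivity) |>.2
  rw [mul_pow, Real.sq_sqrt (by positivity)]
  nlinarith [sq_nonneg (‖A x‖ - ‖adjoint A x‖)]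

theorem norm_inner_comp_add_norm_inner_comp_le (A B X Y : H →L[ℂ] H) {x : H} (hx : ‖x‖ = 1) :
    ‖⟪x, A (X (B x))⟫‖ + ‖⟪x, B (Y (A x))⟫‖ ≤
      ‖B‖ * max ‖X‖ ‖Y‖ * (‖A x‖ + ‖adjoint A x‖) := by
  have h₁ : ‖⟪x, A (X (B x))⟫‖ ≤ ‖adjoint A x‖ * (max ‖X‖ ‖Y‖ * ‖B‖) := by
    rw [← adjoint_inner_left]
    refine (norm_inner_le_norm _ _).trans ?_
    gcongr
    exact (X.le_opNorm _).trans
      (mul_le_mul (le_max_left _ _) (B.unit_le_opNorm x hx.le) (norm_nonneg _) (by positivity))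
  have h₂ : ‖⟪x, B (Y (A x))⟫‖ ≤ ‖B‖ * (max ‖X‖ ‖Y‖ * ‖A x‖) := by
    refine (norm_inner_le_norm _ _).trans ?_
    rw [hx, one_mul]
    refine (B.le_opNorm _).trans ?_
    gcongr
    refine (Y.le_opNorm _).trans ?_
    gcongr
    exact le_max_right _ _
  linarith

/-- For `A, B, X, Y ∈ B(H)` and
`ν = (c(Re A)² + c(Im A)²)/2 + |(‖Re A‖² − ‖Im A‖²)/2 + (c(Im A)² − c(Re A)²)/2|`,
`w(AXB ± BYA) ≤ 2√2·‖B‖·max{‖X‖,‖Y‖}·√(w(A)² − ν)`. -/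
theorem stmt18 (A B X Y : H →L[ℂ] H)
    (ν : ℝ)
    (hν : ν = (crawford (reOp A) ^ 2 + crawford (imOp A) ^ 2) / 2 +
        |(‖reOp A‖ ^ 2 - ‖imOp A‖ ^ 2) / 2 +
          (crawford (imOp A) ^ 2 - crawford (reOp A) ^ 2) / 2|) :
    numRadius (A ∘L X ∘L B + B ∘L Y ∘L A) ≤
        2 * Real.sqrt 2 * ‖B‖ * max ‖X‖ ‖Y‖ * Real.sqrt (numRadius A ^ 2 - ν) ∧
      numRadius (A ∘L X ∘L B - B ∘L Y ∘L A) ≤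
        2 * Real.sqrt 2 * ‖B‖ * max ‖X‖ ‖Y‖ * Real.sqrt (numRadius A ^ 2 - ν) := by
  have hre := norm_reOp_sq_add_crawford_imOp_sq_le A
  have him := norm_imOp_sq_add_crawford_reOp_sq_le A
  have hbound : ‖reOp A‖ ^ 2 + ‖imOp A‖ ^ 2 ≤ 2 * (numRadius A ^ 2 - ν) := by
    rw [hν]
    rcases abs_cases ((‖reOp A‖ ^ 2 - ‖imOp A‖ ^ 2) / 2 +
      (crawford (imOp A) ^ 2 - crawford (reOp A) ^ 2) / 2) with ⟨h, -⟩ | ⟨h, -⟩ <;>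
    rw [h] <;> linarith
  have key : ∀ x : H, ‖x‖ = 1 → ‖⟪x, A (X (B x))⟫‖ + ‖⟪x, B (Y (A x))⟫‖ ≤
      2 * √2 * ‖B‖ * max ‖X‖ ‖Y‖ * √(numRadius A ^ 2 - ν) := fun x hx =>
    calc _ ≤ ‖B‖ * max ‖X‖ ‖Y‖ * (‖A x‖ + ‖adjoint A x‖) :=
          norm_inner_comp_add_norm_inner_comp_le A B X Y hx
      _ ≤ ‖B‖ * max ‖X‖ ‖Y‖ * (2 * √(2 * (numRadius A ^ 2 - ν))) := by
          gcongr
          refine (norm_apply_add_norm_adjoint_apply_le A hx).trans ?_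
          gcongr
      _ = _ := by
          rw [Real.sqrt_mul zero_le_two]
          ring
  refine ⟨numRadius_le fun x hx => le_trans ?_ (key x hx),
    numRadius_le fun x hx => le_trans ?_ (key x hx)⟩
  · simp only [add_apply, comp_apply, inner_add_right]
    exact norm_add_le _ _
  · simp only [sub_apply, comp_apply, inner_sub_right]
    exact norm_sub_le _ _
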